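/- Let E be a finite homogeneous effect algebra such that S(E) = {0, 1}, and let a_i, a_j be atoms of E with a_i ≠ a_j. If x ∈ [a_i, a_i'] and y ∈ [a_j, a_j'], then x ≰ y; moreover [a_i, a_i'] ∩ [a_j, a_j'] = ∅. -/

import Mathlib

namespace EffectAlgebraPaper

/-- An effect algebra: a set with 0, 1 and a partially defined sum `add`,
whose domain is the relation `Orth` (written `a ⊥ b` in the paper). -/
class EffectAlgebra (E : Type*) where
  zero : E
  one : E
  /-- `Orth a b` means `a ⊕ b` is defined. -/
  Orth : E → E → Prop
  /-- The sum `a ⊕ b`, meaningful only when `Orth a b`. -/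
  add : E → E → E
  orth_comm : ∀ a b : E, Orth a b → Orth b a
  add_comm : ∀ a b : E, Orth a b → add a b = add b a
  assoc : ∀ a b c : E, Orth b c → Orth a (add b c) →
    Orth a b ∧ Orth (add a b) c ∧ add a (add b c) = add (add a b) c
  compl_exists : ∀ a : E, ∃! b : E, Orth a b ∧ add a b = one
  orth_one : ∀ a : E, Orth a one → a = zero

namespace EffectAlgebra

variable {E : Type*} [EffectAlgebra E]

/-- The orthosupplement `a'`. -/
noncomputable def compl (a : E) : E := (compl_exists a).exists.choose

/-- The effect-algebra partial order: `a ≤ b` iff `a ⊕ c = b` for some `c`. -/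
def le (a b : E) : Prop := ∃ c : E, Orth a c ∧ add a c = b

/-- The interval `[x, y] = {z : x ≤ z ≤ y}`. -/
def Interval (x y : E) : Set E := { z : E | le x z ∧ le z y }

/-- An atom: a minimal nonzero element. -/
def Atom (a : E) : Prop := a ≠ zero ∧ ∀ b : E, b ≠ zero → le b a → b = a

/-- A sharp element: the only common lower bound of `x` and `x'` is `0`. -/
def Sharp (x : E) : Prop := ∀ b : E, le b x → le b (compl x) → b = zero

/-- `S(E)`, the set of sharp elements. -/
def sharpSet (E : Type*) [EffectAlgebra E] : Set E := { x : E | Sharp x }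

/-- Homogeneity: `u ≤ v₁ ⊕ v₂ ≤ u'` implies `u = u₁ ⊕ u₂` with `u₁ ≤ v₁`, `u₂ ≤ v₂`. -/
def Homogeneous (E : Type*) [EffectAlgebra E] : Prop :=
  ∀ u v₁ v₂ : E, Orth v₁ v₂ → le u (add v₁ v₂) → le (add v₁ v₂) (compl u) →
    ∃ u₁ u₂ : E, le u₁ v₁ ∧ le u₂ v₂ ∧ Orth u₁ u₂ ∧ add u₁ u₂ = u

/-- `nmul n a` is the iterated sum `n·a = a ⊕ ⋯ ⊕ a` (`n` times), with `0·a = 0`;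
it is meaningful only when `nmulDef n a` holds. -/
def nmul : ℕ → E → E
  | 0, _ => zero
  | n + 1, a => add (nmul n a) a

/-- `nmulDef n a` says the iterated sum `n·a` is well defined. -/
def nmulDef : ℕ → E → Prop
  | 0, _ => True
  | n + 1, a => nmulDef n a ∧ Orth (nmul n a) a

end EffectAlgebra

open EffectAlgebra

namespace EffectAlgebra

variable {E : Type*} [EffectAlgebra E]

theorem orth_compl (a : E) : Orth a (compl a) := (compl_exists a).exists.choose_spec.1

theorem add_compl (a : E) : add a (compl a) = one := (compl_exists a).exists.choose_spec.2

theorem eq_compl {a b : E} (h : Orth a b) (h1 : add a b = one) : b = compl a :=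
  (compl_exists a).unique ⟨h, h1⟩ ⟨orth_compl a, add_compl a⟩

theorem assoc_right {a b c : E} (h : Orth a b) (h2 : Orth (add a b) c) :
    Orth b c ∧ Orth a (add b c) ∧ add (add a b) c = add a (add b c) := by
  have hba := orth_comm _ _ h
  have hc := orth_comm _ _ h2
  rw [add_comm _ _ h] at hc
  obtain ⟨h3, h4, h5⟩ := assoc c b a hba hc
  have h6 := orth_comm _ _ h3
  rw [add_comm _ _ h3] at h4 h5
  refine ⟨h6, orth_comm _ _ h4, ?_⟩
  rw [add_comm _ _ h2, add_comm _ _ h, h5, add_comm _ _ h4]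

theorem compl_one : compl (one : E) = zero :=
  orth_one _ (orth_comm _ _ (orth_compl one))

theorem orth_zero_and_add_zero (a : E) : Orth a zero ∧ add a zero = a := by
  have h0 : Orth (one : E) zero := compl_one (E := E) ▸ orth_compl one
  have h1 : add (one : E) zero = one := compl_one (E := E) ▸ add_compl one
  have h2 := orth_comm _ _ (orth_compl a)
  have h3 : add (compl a) a = one := by rw [add_comm _ _ h2, add_compl]
  obtain ⟨h4, h5, h6⟩ := assoc_right h2 (h3 ▸ h0)
  refine ⟨h4, ?_⟩
  rw [h3, h1] at h6
  exact (eq_compl h5 h6.symm).trans (eq_compl h2 h3).symm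

theorem orth_zero (a : E) : Orth a zero := (orth_zero_and_add_zero a).1

theorem add_zero (a : E) : add a zero = a := (orth_zero_and_add_zero a).2

theorem zero_add (a : E) : add zero a = a := by
  rw [add_comm _ _ (orth_comm _ _ (orth_zero a)), add_zero]

theorem le_refl (a : E) : le a a := ⟨zero, orth_zero a, add_zero a⟩

theorem add_left_cancel {a b c : E} (hb : Orth a b) (hc : Orth a c) (h : add a b = add a c) :
    b = c := by
  have hd := orth_comm _ _ (orth_compl (add a b))
  have h1 : add (compl (add a b)) (add a b) = one := by rw [add_comm _ _ hd, add_compl]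
  obtain ⟨-, h3, h4⟩ := assoc _ _ _ hb hd
  obtain ⟨-, h6, h7⟩ := assoc (compl (add a b)) a c hc (by rwa [← h])
  exact (eq_compl h3 (h4 ▸ h1)).trans (eq_compl h6 (by rw [← h7, ← h, h1])).symm

theorem eq_zero_of_add_eq_zero {a b : E} (hab : Orth a b) (h : add a b = zero) : a = zero :=
  orth_one _ (orth_comm _ _ (assoc one a b hab (h ▸ orth_zero one)).1)

theorem eq_zero_of_le_zero {a : E} (h : le a zero) : a = zero :=
  let ⟨_, hc, h⟩ := h
  eq_zero_of_add_eq_zero hc h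

theorem le_trans {a b c : E} (h : le a b) (h2 : le b c) : le a c := by
  obtain ⟨d, hd, rfl⟩ := h
  obtain ⟨e, he, rfl⟩ := h2
  obtain ⟨-, h2, h3⟩ := assoc_right hd he
  exact ⟨_, h2, h3.symm⟩

theorem le_add_left {a b : E} (h : Orth a b) : le a (add a b) := ⟨b, h, rfl⟩

theorem le_add_right {a b : E} (h : Orth a b) : le b (add a b) :=
  ⟨a, orth_comm _ _ h, (add_comm _ _ h).symm⟩

theorem le_compl_iff {a b : E} : le a (compl b) ↔ Orth a b := by
  constructor
  · rintro ⟨c, hc, h⟩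
    exact orth_comm _ _ (assoc b a c hc (h ▸ orth_compl b)).1
  · intro h
    have hba := orth_comm _ _ h
    obtain ⟨h1, h2, h3⟩ := assoc_right hba (orth_compl (add b a))
    exact ⟨_, h1, eq_compl h2 (by rw [← h3, add_compl])⟩

theorem Orth.mono_left {a b c : E} (h : le a b) (h2 : Orth b c) : Orth a c :=
  le_compl_iff.1 (le_trans h (le_compl_iff.2 h2))

theorem Atom.le_or_le (hhom : Homogeneous E) {a v w : E} (ha : Atom a) (hvw : Orth v w)
    (h : le a (add v w)) (h' : Orth (add v w) a) : le a v ∨ le a w := by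
  obtain ⟨u, u', hu, hu', ho, rfl⟩ := hhom a v w hvw h (le_compl_iff.2 h')
  by_cases h0 : u = zero
  · subst h0
    right
    rwa [zero_add]
  · left
    rwa [← ha.2 u h0 (le_add_left ho)]

/-- `IsMultiple a m` says that `m` is a (defined) finite sum of copies of `a`. -/
inductive IsMultiple (a : E) : E → Prop
  | zero : IsMultiple a zero
  | add {m : E} : IsMultiple a m → Orth m a → IsMultiple a (add m a)

theorem IsMultiple.atom_le (hhom : Homogeneous E) {a m : E} (ha : Atom a)
    (hm : IsMultiple a m) {u : E} (hu : u ≠ EffectAlgebra.zero) (hum : le u m)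
    (hmu : Orth m u) : le a u := by
  induction hm generalizing u with
  | zero => exact absurd (eq_zero_of_le_zero hum) hu
  | @add m _ ho ih =>
    obtain ⟨v, w, hv, hw, hvw, rfl⟩ := hhom u m a ho hum (le_compl_iff.2 hmu)
    by_cases h0 : w = EffectAlgebra.zero
    · subst h0
      rw [add_zero] at hu hmu ⊢
      exact ih hu hv (Orth.mono_left (le_add_left ho) hmu)
    · rw [← ha.2 w h0 hw]
      exact le_add_right hvw

theorem IsMultiple.eq_zero_or_le {a m : E} (hm : IsMultiple a m) :
    m = EffectAlgebra.zero ∨ le a m := by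
  cases hm with
  | zero => exact Or.inl rfl
  | add _ ho => exact Or.inr (le_add_right ho)

theorem exists_isMultiple_not_orth [Finite E] {a : E} (ha : a ≠ zero) :
    ∃ m, IsMultiple a m ∧ ¬ Orth m a := by
  let _ : Preorder E := { le := le, le_refl := le_refl, le_trans := fun _ _ _ => le_trans }
  obtain ⟨m, hm, hmax⟩ := (Set.toFinite {m : E | IsMultiple a m}).exists_maximal ⟨_, .zero⟩
  refine ⟨m, hm, fun ho => ha ?_⟩
  obtain ⟨d, hd, h⟩ : le (add m a) m := hmax (IsMultiple.add hm ho) (le_add_left ho)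
  obtain ⟨h1, h2, h3⟩ := assoc_right ho hd
  refine eq_zero_of_add_eq_zero h1 (add_left_cancel h2 (orth_zero m) ?_)
  rw [← h3, h, add_zero]

theorem isMultiple_one [Finite E] (hhom : Homogeneous E) (hS : sharpSet E = {zero, one}) {a : E}
    (ha : Atom a) : IsMultiple a one := by
  obtain ⟨m, hm, hma⟩ := exists_isMultiple_not_orth ha.1
  have hsharp : m ∈ sharpSet E := by
    intro u hu hu'
    by_contra h0
    have h := le_compl_iff.1 hu'
    exact hma (orth_comm _ _
      (Orth.mono_left (hm.atom_le hhom ha h0 hu (orth_comm _ _ h)) h))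
  rw [hS] at hsharp
  rcases hsharp with rfl | rfl
  · exact absurd (orth_comm _ _ (orth_zero a)) hma
  · exact hm

theorem IsMultiple.orth_atom (hhom : Homogeneous E) {a c m : E} (ha : Atom a) (hc : Atom c)
    (hac : a ≠ c) (ho : Orth a c) (hm : IsMultiple a m) : Orth m c := by
  induction hm with
  | zero => exact orth_comm _ _ (orth_zero c)
  | @add m hm hma ih =>
    rcases hm.eq_zero_or_le with rfl | ham
    · rwa [zero_add]
    obtain ⟨r, hcr, hr⟩ := le_compl_iff.2 (orth_comm _ _ ih)
    have hle : le a (EffectAlgebra.add c r) := hr ▸ le_compl_iff.2 (orth_comm _ _ hma)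
    have hor : Orth (EffectAlgebra.add c r) a :=
      hr ▸ orth_comm _ _ (Orth.mono_left ham (orth_compl m))
    rcases ha.le_or_le hhom hcr hle hor with h | h
    · exact absurd (hc.2 a ha.1 h) hac
    · obtain ⟨s, hs, rfl⟩ := h
      obtain ⟨h2, h3, h4⟩ := assoc c a s hs hcr
      have h5 : Orth m (EffectAlgebra.add c a) :=
        orth_comm _ _ (Orth.mono_left (le_add_left h3)
          (by rw [← h4, hr]; exact orth_comm _ _ (orth_compl m)))
      rw [add_comm _ _ h2] at h5
      exact (assoc m a c ho h5).2.1

/-- Distinct atoms are never orthogonal when the only sharp elements are `0` and `1`. -/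
theorem Atom.not_orth [Finite E] (hhom : Homogeneous E) (hS : sharpSet E = {zero, one}) {a c : E}
    (ha : Atom a) (hc : Atom c) (hac : a ≠ c) : ¬ Orth a c := fun ho =>
  hc.1 (orth_one c (orth_comm _ _
    ((isMultiple_one hhom hS ha).orth_atom hhom ha hc hac ho)))

end EffectAlgebra

/-- Corollary 1 (cor1): in a finite homogeneous effect algebra with `S(E) = {0, 1}`,
if `aᵢ ≠ aⱼ` are atoms, then no `x ∈ [aᵢ, aᵢ']` is below any `y ∈ [aⱼ, aⱼ']`,
and `[aᵢ, aᵢ'] ∩ [aⱼ, aⱼ'] = ∅`. -/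
theorem stmt9 {E : Type*} [EffectAlgebra E] [Finite E] (hhom : Homogeneous E)
    (hS : sharpSet E = {zero, one})
    (ai aj : E) (hi : Atom ai) (hj : Atom aj) (hij : ai ≠ aj) :
    (∀ x ∈ Interval ai (compl ai), ∀ y ∈ Interval aj (compl aj), ¬ le x y) ∧
      Interval ai (compl ai) ∩ Interval aj (compl aj) = ∅ := by
  have key : ∀ x ∈ Interval ai (compl ai), ∀ y ∈ Interval aj (compl aj), ¬ le x y :=
    fun x hx y hy hxy => hi.not_orth hhom hS hj hij
      (le_compl_iff.1 (le_trans hx.1 (le_trans hxy hy.2)))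
  exact ⟨key, Set.eq_empty_iff_forall_notMem.2 fun x hx => key x hx.1 x hx.2 (le_refl x)⟩

end EffectAlgebraPaper
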